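/- Let c ∈ ℝ and R > 0 be such that every eigenvalue of A and every eigenvalue of T lies in the open disk { z : |z − c| < R }, let f : ℂ → ℂ be complex differentiable on an open set containing the closed disk { z : |z − c| ≤ R }, and let w ∈ ℝ be such that w is not an eigenvalue of A or of T. Let S₀, S₁, …, S_k be nonempty compact subsets of ℝ, each disjoint from the circle { z : |z − c| = R }, such that every eigenvalue of A lies in S₀ and the i-th eigenvalue λ_i(T) of T lies in S_i for i = 1, …, k. Let M be an n×n Hermitian positive definite matrix commuting with A and set ‖v‖_M := √(vᴴ M v). Then ‖f(A)b − Q f(T) Qᴴ b‖_M ≤ ( (1/(2π)) ∫₀^{2π} |f(c + Re^{iθ})| · ( ∏_{i=1}^{k} sup_{x ∈ S_i} |(x − w)/(x − (c + Re^{iθ}))| ) · ( sup_{x ∈ S₀} |(x − w)/(x − (c + Re^{iθ}))| ) · R dθ ) · ‖err_k(w)‖_M. -/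

import Mathlib

open Matrix MeasureTheory
open scoped ComplexOrder

/-- The Euclidean 2-norm of a complex vector. -/
noncomputable def norm2 {n : ℕ} (v : Fin n → ℂ) : ℝ :=
  Real.sqrt (∑ i, ‖v i‖ ^ 2)

/-- Apply a scalar function to a Hermitian matrix through its spectral decomposition. -/
noncomputable def matFun {m : ℕ} {B : Matrix (Fin m) (Fin m) ℂ}
    (hB : B.IsHermitian) (f : ℝ → ℂ) : Matrix (Fin m) (Fin m) ℂ :=
  (hB.eigenvectorUnitary : Matrix (Fin m) (Fin m) ℂ) *
    Matrix.diagonal (fun i => f (hB.eigenvalues i)) *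
    star (hB.eigenvectorUnitary : Matrix (Fin m) (Fin m) ℂ)

/-- The Lanczos-FA error for the shifted linear system `(A - z I) x = b`. -/
noncomputable def errK {n k : ℕ} (A : Matrix (Fin n) (Fin n) ℂ) (Q : Matrix (Fin n) (Fin k) ℂ)
    (T : Matrix (Fin k) (Fin k) ℂ) (b : Fin n → ℂ) (z : ℂ) : Fin n → ℂ :=
  (A - z • 1)⁻¹.mulVec b - (Q * (T - z • 1)⁻¹ * Qᴴ).mulVec b

/-- The Lanczos-FA residual for the shifted linear system `(A - z I) x = b`. -/
noncomputable def resK {n k : ℕ} (A : Matrix (Fin n) (Fin n) ℂ) (Q : Matrix (Fin n) (Fin k) ℂ)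
    (T : Matrix (Fin k) (Fin k) ℂ) (b : Fin n → ℂ) (z : ℂ) : Fin n → ℂ :=
  b - ((A - z • 1) * (Q * (T - z • 1)⁻¹ * Qᴴ)).mulVec b

/-- The norm induced by a positive definite matrix `M`: `‖v‖_M = sqrt (vᴴ M v)`. -/
noncomputable def normM {n : ℕ} (M : Matrix (Fin n) (Fin n) ℂ) (v : Fin n → ℂ) : ℝ :=
  Real.sqrt ((star v ⬝ᵥ M.mulVec v).re)

section MatFun

variable {m : ℕ} {B : Matrix (Fin m) (Fin m) ℂ} (hB : B.IsHermitian)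

theorem matFun_congr {f g : ℝ → ℂ} (h : ∀ i, f (hB.eigenvalues i) = g (hB.eigenvalues i)) :
    matFun hB f = matFun hB g := by
  simp only [matFun, h]

theorem matFun_mul (f g : ℝ → ℂ) :
    matFun hB f * matFun hB g = matFun hB (fun x => f x * g x) := by
  have hU : star (hB.eigenvectorUnitary : Matrix (Fin m) (Fin m) ℂ) *
      (hB.eigenvectorUnitary : Matrix (Fin m) (Fin m) ℂ) = 1 := by simp
  simp only [matFun]
  rw [← Matrix.diagonal_mul_diagonal]
  simp only [Matrix.mul_assoc]
  rw [← Matrix.mul_assoc (star _) _ (Matrix.diagonal _ * _), hU, Matrix.one_mul]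

theorem matFun_add (f g : ℝ → ℂ) :
    matFun hB f + matFun hB g = matFun hB (fun x => f x + g x) := by
  simp only [matFun]
  rw [← Matrix.diagonal_add, Matrix.mul_add, Matrix.add_mul]

theorem matFun_const (a : ℂ) : matFun hB (fun _ => a) = a • 1 := by
  have hU : (hB.eigenvectorUnitary : Matrix (Fin m) (Fin m) ℂ) *
      star (hB.eigenvectorUnitary : Matrix (Fin m) (Fin m) ℂ) = 1 := by simp
  simp only [matFun]
  rw [← Matrix.smul_one_eq_diagonal]
  simp [hU]

theorem matFun_ofReal : matFun hB (fun x => (x : ℂ)) = B := by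
  conv_rhs => rw [hB.spectral_theorem]
  rfl

theorem matFun_conjTranspose (f : ℝ → ℂ) :
    (matFun hB f)ᴴ = matFun hB (fun x => star (f x)) := by
  simp only [matFun, Matrix.star_eq_conjTranspose, Matrix.conjTranspose_mul,
    Matrix.conjTranspose_conjTranspose, Matrix.diagonal_conjTranspose, Matrix.mul_assoc]
  rfl

theorem matFun_sub_const (z : ℂ) : matFun hB (fun x => (x : ℂ) - z) = B - z • 1 := by
  simp only [sub_eq_add_neg]
  rw [← matFun_add, matFun_ofReal, matFun_const, neg_smul]

theorem det_sub_smul_one (z : ℂ) :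
    (B - z • 1).det = ∏ i, ((hB.eigenvalues i : ℂ) - z) := by
  have hU : star (hB.eigenvectorUnitary : Matrix (Fin m) (Fin m) ℂ) *
      (hB.eigenvectorUnitary : Matrix (Fin m) (Fin m) ℂ) = 1 := by simp
  rw [← matFun_sub_const hB, matFun, Matrix.det_mul_comm, ← Matrix.mul_assoc, hU,
    Matrix.one_mul, Matrix.det_diagonal]

/-- The resolvent of a Hermitian matrix is a function of that matrix. -/
theorem inv_sub_smul_one {z : ℂ} (hz : ∀ i, (hB.eigenvalues i : ℂ) ≠ z) :
    (B - z • 1)⁻¹ = matFun hB (fun x => ((x : ℂ) - z)⁻¹) := by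
  apply Matrix.inv_eq_right_inv
  rw [← matFun_sub_const hB, matFun_mul, matFun_congr hB (g := fun _ => 1), matFun_const, one_smul]
  intro i
  exact mul_inv_cancel₀ (sub_ne_zero.2 (hz i))

/-- A matrix commuting with `B` commutes with every function of `B`. -/
theorem Commute.matFun_right {X : Matrix (Fin m) (Fin m) ℂ} (h : Commute X B) (f : ℝ → ℂ) :
    Commute X (matFun hB f) := by
  set U : Matrix (Fin m) (Fin m) ℂ := (hB.eigenvectorUnitary : Matrix (Fin m) (Fin m) ℂ) with hU
  have hUU : star U * U = 1 := by simp [hU]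
  have hUU' : U * star U = 1 := by simp [hU]
  have key : ∀ g : ℝ → ℂ, Commute X (matFun hB g) ↔
      Commute (star U * X * U) (Matrix.diagonal fun i => g (hB.eigenvalues i)) := by
    intro g
    set D := Matrix.diagonal fun i => g (hB.eigenvalues i) with hD
    have e1 : star U * (X * (U * D * star U)) * U = star U * X * U * D := by
      simp only [Matrix.mul_assoc, hUU, Matrix.mul_one]
    have e2 : star U * ((U * D * star U) * X) * U = D * (star U * X * U) := by
      rw [show star U * ((U * D * star U) * X) * U = (star U * U) * (D * (star U * X * U)) by
        simp only [Matrix.mul_assoc], hUU, Matrix.one_mul]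
    have cancel : ∀ Y Z : Matrix (Fin m) (Fin m) ℂ, star U * Y * U = star U * Z * U → Y = Z := by
      intro Y Z hYZ
      have e : ∀ W : Matrix (Fin m) (Fin m) ℂ, U * (star U * W * U) * star U = W := fun W => by
        rw [show U * (star U * W * U) * star U = (U * star U) * W * (U * star U) by
          simp only [Matrix.mul_assoc], hUU', Matrix.one_mul, Matrix.mul_one]
      rw [← e Y, hYZ, e Z]
    change X * (U * D * star U) = (U * D * star U) * X ↔ star U * X * U * D = D * (star U * X * U)
    rw [← e1, ← e2]
    exact ⟨fun hc => by rw [hc], fun hc => cancel _ _ hc⟩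
  have hid := (key fun x => (x : ℂ)).1 (by rwa [matFun_ofReal])
  rw [key]
  ext i j
  have hij := congrFun (congrFun hid i) j
  simp only [Matrix.mul_diagonal, Matrix.diagonal_mul] at hij ⊢
  by_cases he : hB.eigenvalues i = hB.eigenvalues j
  · rw [he, mul_comm]
  · have hne : (hB.eigenvalues j : ℂ) - hB.eigenvalues i ≠ 0 :=
      sub_ne_zero.2 fun hc => he (Complex.ofReal_injective hc).symm
    have h0 : (star U * X * U) i j = 0 :=
      (mul_eq_zero.1 (show (star U * X * U) i j * ((hB.eigenvalues j : ℂ) - hB.eigenvalues i) = 0 by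
        linear_combination hij)).resolve_right hne
    rw [h0, zero_mul, mul_zero]

/-- Functions of a Hermitian matrix are linear combinations of fixed spectral projections. -/
theorem exists_matFun_eq_sum : ∃ P : Fin m → Matrix (Fin m) (Fin m) ℂ,
    ∀ f : ℝ → ℂ, matFun hB f = ∑ i, f (hB.eigenvalues i) • P i := by
  refine ⟨fun i => (hB.eigenvectorUnitary : Matrix (Fin m) (Fin m) ℂ) *
    Matrix.single i i 1 * star (hB.eigenvectorUnitary : Matrix (Fin m) (Fin m) ℂ), fun f => ?_⟩
  have hD : Matrix.diagonal (fun i => f (hB.eigenvalues i)) =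
      ∑ i, f (hB.eigenvalues i) • (Matrix.single i i 1 : Matrix (Fin m) (Fin m) ℂ) := by
    rw [← Matrix.sum_single_eq_diagonal]
    simp
  rw [matFun, hD, Matrix.mul_sum, Matrix.sum_mul]
  simp only [Matrix.mul_smul, Matrix.smul_mul]

end MatFun

section NormM

variable {n : ℕ} {M : Matrix (Fin n) (Fin n) ℂ}

/-- The norm induced by `M` is the Euclidean norm after a linear change of variables. -/
theorem exists_normM_eq_norm (hM : M.PosDef) :
    ∃ L : (Fin n → ℂ) →ₗ[ℂ] EuclideanSpace ℂ (Fin n), ∀ v, normM M v = ‖L v‖ := by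
  set N := matFun hM.1 (fun x => ((Real.sqrt x : ℝ) : ℂ)) with hN
  have hNN : Nᴴ * N = M := by
    rw [hN, matFun_conjTranspose, matFun_mul]
    refine (matFun_congr hM.1 fun i => ?_).trans (matFun_ofReal hM.1)
    have := Real.mul_self_sqrt (hM.eigenvalues_pos i).le
    simp only [RCLike.star_def, Complex.conj_ofReal]
    exact_mod_cast this
  refine ⟨(WithLp.linearEquiv 2 ℂ (Fin n → ℂ)).symm.toLinearMap ∘ₗ N.mulVecLin, fun v => ?_⟩
  rw [normM, ← hNN, ← Matrix.mulVec_mulVec, Matrix.dotProduct_mulVec, Matrix.vecMul_conjTranspose,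
    star_star, EuclideanSpace.norm_eq]
  congr 1
  simp [dotProduct, Complex.conj_mul', ← Complex.ofReal_pow]

/-- A function of `A` bounded by `s` on the spectrum has operator norm at most `s` in every norm
induced by a positive definite matrix commuting with `A`. -/
theorem normM_matFun_mulVec_le (hM : M.PosDef) {A : Matrix (Fin n) (Fin n) ℂ} (hA : A.IsHermitian)
    (hMA : Commute M A) (g : ℝ → ℂ) {s : ℝ} (hs : 0 ≤ s) (hg : ∀ i, ‖g (hA.eigenvalues i)‖ ≤ s)
    (v : Fin n → ℂ) : normM M (matFun hA g *ᵥ v) ≤ s * normM M v := by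
  set E := matFun hA (fun x => ((Real.sqrt (s ^ 2 - ‖g x‖ ^ 2) : ℝ) : ℂ)) with hE
  set G := matFun hA g with hG
  have hcomm : ∀ h : ℝ → ℂ, (matFun hA h)ᴴ * M * matFun hA h =
      M * matFun hA (fun x => star (h x) * h x) := by
    intro h
    rw [matFun_conjTranspose, ← (hMA.matFun_right hA _).eq, Matrix.mul_assoc, matFun_mul]
  have hsum : Eᴴ * M * E + Gᴴ * M * G = ((s ^ 2 : ℝ) : ℂ) • M := by
    rw [hE, hG, hcomm, hcomm, ← Matrix.mul_add, matFun_add,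
      matFun_congr hA (g := fun _ => ((s ^ 2 : ℝ) : ℂ)), matFun_const]
    · simp
    · intro i
      have h1 : 0 ≤ s ^ 2 - ‖g (hA.eigenvalues i)‖ ^ 2 :=
        sub_nonneg.2 (pow_le_pow_left₀ (norm_nonneg _) (hg i) 2)
      have h2 := Real.mul_self_sqrt h1
      simp only [RCLike.star_def, Complex.conj_ofReal, Complex.conj_mul']
      rw [← Complex.ofReal_mul, h2]
      push_cast
      ring
  have hquad : ∀ X : Matrix (Fin n) (Fin n) ℂ,
      star (X *ᵥ v) ⬝ᵥ M *ᵥ (X *ᵥ v) = star v ⬝ᵥ (Xᴴ * M * X) *ᵥ v := by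
    intro X
    simp only [Matrix.star_mulVec, Matrix.dotProduct_mulVec, Matrix.vecMul_vecMul,
      Matrix.mul_assoc]
  have hEnn : 0 ≤ (star (E *ᵥ v) ⬝ᵥ M *ᵥ (E *ᵥ v)).re :=
    (Complex.le_def.1 (hM.posSemidef.dotProduct_mulVec_nonneg (E *ᵥ v))).1
  have hre : (star (G *ᵥ v) ⬝ᵥ M *ᵥ (G *ᵥ v)).re ≤ s ^ 2 * (star v ⬝ᵥ M *ᵥ v).re := by
    have h := congrArg (fun X : Matrix (Fin n) (Fin n) ℂ => (star v ⬝ᵥ X *ᵥ v).re) hsum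
    simp only [Matrix.add_mulVec, dotProduct_add, Complex.add_re, Matrix.smul_mulVec,
      dotProduct_smul, smul_eq_mul, Complex.re_ofReal_mul] at h
    rw [← hquad, ← hquad] at h
    linarith
  calc normM M (G *ᵥ v) ≤ Real.sqrt (s ^ 2 * (star v ⬝ᵥ M *ᵥ v).re) := Real.sqrt_le_sqrt hre
    _ = s * normM M v := by rw [Real.sqrt_mul (sq_nonneg s), Real.sqrt_sq hs, normM]

end NormM

section Lanczos

variable {n k : ℕ}

/-- For a tridiagonal matrix `T`, the corner entry of the adjugate of `T - z` does not depend
on the shift `z`. -/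
theorem adjugate_tridiagonal_sub_smul_one (hk : 0 < k) {T : Matrix (Fin k) (Fin k) ℂ}
    (hT : ∀ i j : Fin k, (j : ℕ) + 1 < (i : ℕ) → T i j = 0) (z w : ℂ) :
    (T - z • 1).adjugate ⟨k - 1, Nat.sub_lt hk Nat.one_pos⟩ ⟨0, hk⟩ =
      (T - w • 1).adjugate ⟨k - 1, Nat.sub_lt hk Nat.one_pos⟩ ⟨0, hk⟩ := by
  obtain ⟨m, rfl⟩ : ∃ m, k = m + 1 := ⟨k - 1, by omega⟩
  have h0 : (⟨0, hk⟩ : Fin (m + 1)) = 0 := rfl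
  have hl : (⟨m + 1 - 1, Nat.sub_lt hk Nat.one_pos⟩ : Fin (m + 1)) = Fin.last m := rfl
  have hdet : ∀ z : ℂ, ((T - z • 1).submatrix (0 : Fin (m + 1)).succAbove
      (Fin.last m).succAbove).det = ∏ i : Fin m, T i.succ i.castSucc := by
    intro z
    have hne : ∀ i j : Fin m, j ≤ i → i.succ ≠ j.castSucc := fun i j hij h => by
      have h1 := congrArg Fin.val h
      have h2 : (j : ℕ) ≤ i := hij
      simp at h1
      omega
    rw [Matrix.det_of_isUpperTriangular]
    · refine Finset.prod_congr rfl fun i _ => ?_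
      simp [Matrix.one_apply_ne (hne i i le_rfl)]
    · intro i j hij
      have hij' : j < i := hij
      have hT0 : T i.succ j.castSucc = 0 := hT _ _ (by simpa using hij')
      simp [Matrix.one_apply_ne (hne i j hij'.le), hT0]
  rw [h0, hl, Matrix.adjugate_fin_succ_eq_det_submatrix, Matrix.adjugate_fin_succ_eq_det_submatrix,
    hdet, hdet]

/-- The errors of the Lanczos approximations to two shifted systems are related by a
rational function of `A`. -/
theorem errK_eq_smul_matFun_mulVec (hk : 0 < k)
    {A : Matrix (Fin n) (Fin n) ℂ} (hA : A.IsHermitian)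
    {b : Fin n → ℂ} {Q : Matrix (Fin n) (Fin k) ℂ} (hQ : Qᴴ * Q = 1) {a : ℂ}
    (hQb : b = a • Q *ᵥ Pi.single (⟨0, hk⟩ : Fin k) 1)
    {T : Matrix (Fin k) (Fin k) ℂ} (hTH : T.IsHermitian)
    (hT : ∀ i j : Fin k, (j : ℕ) + 1 < (i : ℕ) → T i j = 0)
    {β : ℂ} {q : Fin n → ℂ}
    (hAQ : A * Q = Q * T + β •
      Matrix.vecMulVec q (Pi.single (⟨k - 1, Nat.sub_lt hk Nat.one_pos⟩ : Fin k) 1))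
    {z w : ℂ} (hzA : ∀ i, (hA.eigenvalues i : ℂ) ≠ z) (hzT : ∀ i, (hTH.eigenvalues i : ℂ) ≠ z)
    (hwA : ∀ i, (hA.eigenvalues i : ℂ) ≠ w) (hwT : ∀ i, (hTH.eigenvalues i : ℂ) ≠ w) :
    errK A Q T b z = (∏ i, ((hTH.eigenvalues i : ℂ) - w) / ((hTH.eigenvalues i : ℂ) - z)) •
      matFun hA (fun x => ((x : ℂ) - w) / ((x : ℂ) - z)) *ᵥ errK A Q T b w := by
  set κ : ℂ := (T - w • 1).adjugate ⟨k - 1, Nat.sub_lt hk Nat.one_pos⟩ ⟨0, hk⟩ with hκ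
  have hres : ∀ u : ℂ, (∀ i, (hA.eigenvalues i : ℂ) ≠ u) → (∀ i, (hTH.eigenvalues i : ℂ) ≠ u) →
      errK A Q T b u = (-(a * β * κ) * (∏ i, ((hTH.eigenvalues i : ℂ) - u))⁻¹) •
        matFun hA (fun x => ((x : ℂ) - u)⁻¹) *ᵥ q := by
    intro u huA huT
    have hdet : (T - u • 1).det ≠ 0 := by
      rw [det_sub_smul_one hTH]
      exact Finset.prod_ne_zero_iff.2 fun i _ => sub_ne_zero.2 (huT i)
    have hdetA : (A - u • 1).det ≠ 0 := by
      rw [det_sub_smul_one hA]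
      exact Finset.prod_ne_zero_iff.2 fun i _ => sub_ne_zero.2 (huA i)
    have hshift : (A - u • 1) * Q = Q * (T - u • 1) + β •
        Matrix.vecMulVec q (Pi.single (⟨k - 1, Nat.sub_lt hk Nat.one_pos⟩ : Fin k) 1) := by
      rw [Matrix.sub_mul, hAQ, Matrix.mul_sub]
      simp only [Matrix.smul_mul, Matrix.mul_smul, Matrix.one_mul, Matrix.mul_one]
      abel
    have hQHb : Qᴴ *ᵥ b = a • Pi.single (⟨0, hk⟩ : Fin k) 1 := by
      rw [hQb, Matrix.mulVec_smul, Matrix.mulVec_mulVec, hQ, Matrix.one_mulVec]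
    have hcorner : (T - u • 1)⁻¹ ⟨k - 1, Nat.sub_lt hk Nat.one_pos⟩ ⟨0, hk⟩ =
        (∏ i, ((hTH.eigenvalues i : ℂ) - u))⁻¹ * κ := by
      rw [Matrix.inv_def, Ring.inverse_eq_inv', det_sub_smul_one hTH, Matrix.smul_apply,
        adjugate_tridiagonal_sub_smul_one hk hT u w, smul_eq_mul]
    have hTT : (T - u • 1) * (T - u • 1)⁻¹ = 1 := Matrix.mul_nonsing_inv _ hdet.isUnit
    have hAA : (A - u • 1)⁻¹ * (A - u • 1) = 1 := Matrix.nonsing_inv_mul _ hdetA.isUnit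
    have hresid : b - (A - u • 1) *ᵥ ((Q * (T - u • 1)⁻¹ * Qᴴ) *ᵥ b) =
        (-(a * β * κ) * (∏ i, ((hTH.eigenvalues i : ℂ) - u))⁻¹) • q := by
      rw [← Matrix.mulVec_mulVec, hQHb, Matrix.mulVec_mulVec, ← Matrix.mul_assoc, hshift,
        Matrix.add_mul, Matrix.mul_assoc, hTT, Matrix.mul_one, Matrix.add_mulVec,
        Matrix.mulVec_smul, ← hQb, Matrix.smul_mul, Matrix.smul_mulVec, ← Matrix.mulVec_mulVec,
        Matrix.mulVec_smul, Matrix.mulVec_single_one, Matrix.mulVec_smul,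
        Matrix.vecMulVec_mulVec]
      simp only [single_one_dotProduct, Matrix.col_apply, hcorner]
      ext i
      simp
      ring
    calc errK A Q T b u
        = (A - u • 1)⁻¹ *ᵥ (b - (A - u • 1) *ᵥ ((Q * (T - u • 1)⁻¹ * Qᴴ) *ᵥ b)) := by
          rw [Matrix.mulVec_sub, Matrix.mulVec_mulVec, hAA, Matrix.one_mulVec, errK]
      _ = _ := by rw [hresid, Matrix.mulVec_smul, inv_sub_smul_one hA huA]
  rw [hres z hzA hzT, hres w hwA hwT, Matrix.mulVec_smul, Matrix.mulVec_mulVec, matFun_mul,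
    smul_smul]
  have hw0 : ∏ i, ((hTH.eigenvalues i : ℂ) - w) ≠ 0 :=
    Finset.prod_ne_zero_iff.2 fun i _ => sub_ne_zero.2 (hwT i)
  congr 1
  · rw [Finset.prod_div_distrib]
    field_simp
  · congr 1
    refine matFun_congr hA fun i => ?_
    have := sub_ne_zero.2 (hwA i)
    field_simp

end Lanczos

/-- Cauchy's formula for `f(A) b - Q f(T) Qᴴ b` in terms of the errors for shifted systems. -/
theorem two_pi_I_smul_matFun_error {n k : ℕ} {A : Matrix (Fin n) (Fin n) ℂ} (hA : A.IsHermitian)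
    (b : Fin n → ℂ) (Q : Matrix (Fin n) (Fin k) ℂ) {T : Matrix (Fin k) (Fin k) ℂ}
    (hT : T.IsHermitian) {c R : ℝ} (hR : 0 < R) (hspecA : ∀ i, |hA.eigenvalues i - c| < R)
    (hspecT : ∀ i, |hT.eigenvalues i - c| < R) {f : ℂ → ℂ}
    (hf : DifferentiableOn ℂ f (Metric.closedBall (c : ℂ) R))
    {E : Type*} [NormedAddCommGroup E] [NormedSpace ℂ E] [CompleteSpace E]
    (L : (Fin n → ℂ) →ₗ[ℂ] E) :
    (2 * Real.pi * Complex.I : ℂ) • L ((matFun hA fun x : ℝ => f x) *ᵥ b -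
      (Q * matFun hT (fun x : ℝ => f x) * Qᴴ) *ᵥ b) =
      -∮ z in C((c : ℂ), R), f z • L (errK A Q T b z) := by
  obtain ⟨P, hP⟩ := exists_matFun_eq_sum hA
  obtain ⟨P', hP'⟩ := exists_matFun_eq_sum hT
  have hball : ∀ x : ℝ, |x - c| < R → (x : ℂ) ∈ Metric.ball (c : ℂ) R := fun x hx => by
    rw [Metric.mem_ball, Complex.dist_eq, ← Complex.ofReal_sub, Complex.norm_real]
    exact hx
  have hne : ∀ x : ℝ, |x - c| < R → ∀ z ∈ Metric.sphere (c : ℂ) R, (x : ℂ) ≠ z :=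
    fun x hx z hz h => (Metric.mem_ball.1 (hball x hx)).ne (h ▸ Metric.mem_sphere.1 hz)
  have hexp : ∀ g : ℝ → ℂ, L (matFun hA g *ᵥ b - (Q * matFun hT g * Qᴴ) *ᵥ b) =
      ∑ i, g (hA.eigenvalues i) • L (P i *ᵥ b) -
        ∑ i, g (hT.eigenvalues i) • L ((Q * P' i * Qᴴ) *ᵥ b) := by
    intro g
    rw [hP, hP', map_sub, Matrix.mul_sum, Matrix.sum_mul, Matrix.sum_mulVec, Matrix.sum_mulVec,
      map_sum, map_sum]
    simp only [Matrix.mul_smul, Matrix.smul_mul, Matrix.smul_mulVec, map_smul]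
  have hcauchy : ∀ x : ℝ, |x - c| < R → ∀ v : E,
      (∮ z in C((c : ℂ), R), (z - x)⁻¹ • f z • v) = (2 * Real.pi * Complex.I : ℂ) • f x • v :=
    fun x hx v => DifferentiableOn.circleIntegral_sub_inv_smul (hf.smul_const v) (hball x hx)
  have hint : ∀ x : ℝ, |x - c| < R → ∀ v : E,
      CircleIntegrable (fun z => (z - x)⁻¹ • f z • v) c R := by
    intro x hx v
    refine ContinuousOn.circleIntegrable hR.le (ContinuousOn.smul ?_ ?_)
    · exact (continuousOn_id.sub continuousOn_const).inv₀
        fun z hz => sub_ne_zero.2 (hne x hx z hz).symm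
    · exact (hf.continuousOn.mono Metric.sphere_subset_closedBall).smul continuousOn_const
  have hcongr : (∮ z in C((c : ℂ), R), f z • L (errK A Q T b z)) =
      ∮ z in C((c : ℂ), R),
        (∑ i, (z - hT.eigenvalues i)⁻¹ • f z • L ((Q * P' i * Qᴴ) *ᵥ b) -
          ∑ i, (z - hA.eigenvalues i)⁻¹ • f z • L (P i *ᵥ b)) := by
    refine circleIntegral.integral_congr hR.le fun z hz => ?_
    rw [errK, inv_sub_smul_one hA fun i => hne _ (hspecA i) z hz,
      inv_sub_smul_one hT fun i => hne _ (hspecT i) z hz, hexp, smul_sub, Finset.smul_sum,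
      Finset.smul_sum, sub_eq_neg_add, sub_eq_add_neg, ← Finset.sum_neg_distrib]
    congr 1
    · refine Finset.sum_congr rfl fun i _ => ?_
      rw [smul_smul, smul_smul, ← neg_smul, ← neg_sub, inv_neg]
      ring_nf
    · rw [← Finset.sum_neg_distrib]
      refine Finset.sum_congr rfl fun i _ => ?_
      rw [smul_smul, smul_smul, ← neg_smul, ← neg_sub, inv_neg]
      ring_nf
  rw [hcongr, circleIntegral.integral_sub, circleIntegral.integral_fun_sum,
    circleIntegral.integral_fun_sum, hexp, smul_sub, Finset.smul_sum, Finset.smul_sum, neg_sub]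
  · simp only [hcauchy _ (hspecA _), hcauchy _ (hspecT _)]
  · exact fun i _ => hint _ (hspecA i) _
  · exact fun i _ => hint _ (hspecT i) _
  · exact CircleIntegrable.fun_sum _ fun i _ => hint _ (hspecT i) _
  · exact CircleIntegrable.fun_sum _ fun i _ => hint _ (hspecA i) _

section Supremum

variable {K : Set ℝ} {c R : ℝ}

theorem ofReal_sub_circleMap_ne_zero (hR : 0 < R) {x : ℝ} (hx : |x - c| ≠ R) (θ : ℝ) :
    (x : ℂ) - circleMap c R θ ≠ 0 := by
  intro h
  apply hx
  have h1 := circleMap_mem_sphere (c : ℂ) hR.le θ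
  rw [← sub_eq_zero.1 h, Metric.mem_sphere, Complex.dist_eq, ← Complex.ofReal_sub,
    Complex.norm_real] at h1
  exact h1

/-- The supremum of a rational function over a compact set avoiding the circle depends
continuously on the pole on that circle. -/
theorem continuous_sSup_norm_div_circleMap (hR : 0 < R) (hK : IsCompact K)
    (hKc : ∀ x ∈ K, |x - c| ≠ R) (w : ℂ) :
    Continuous fun θ : ℝ =>
      sSup ((fun x : ℝ => ‖((x : ℂ) - w) / ((x : ℂ) - circleMap c R θ)‖) '' K) := by
  have : CompactSpace K := isCompact_iff_compactSpace.1 hK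
  have h := IsCompact.continuous_sSup (K := (Set.univ : Set K))
    (f := fun (θ : ℝ) (x : K) => ‖(((x : ℝ) : ℂ) - w) / (((x : ℝ) : ℂ) - circleMap c R θ)‖)
    isCompact_univ (by
      have hcm := continuous_circleMap (c : ℂ) R
      change Continuous fun p : ℝ × K =>
        ‖(((p.2 : ℝ) : ℂ) - w) / (((p.2 : ℝ) : ℂ) - circleMap c R p.1)‖
      refine Continuous.norm (Continuous.div ?_ ?_ ?_)
      · fun_prop
      · fun_prop
      · exact fun p => ofReal_sub_circleMap_ne_zero hR (hKc _ p.2.2) p.1)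
  refine h.congr fun θ => congrArg sSup ?_
  ext y
  simp

theorem norm_div_circleMap_le_sSup (hR : 0 < R) (hK : IsCompact K)
    (hKc : ∀ x ∈ K, |x - c| ≠ R) (w : ℂ) (θ : ℝ) {x : ℝ} (hx : x ∈ K) :
    ‖((x : ℂ) - w) / ((x : ℂ) - circleMap c R θ)‖ ≤
      sSup ((fun x : ℝ => ‖((x : ℂ) - w) / ((x : ℂ) - circleMap c R θ)‖) '' K) := by
  refine le_csSup (IsCompact.bddAbove (hK.image_of_continuousOn ?_)) (Set.mem_image_of_mem _ hx)
  refine (ContinuousOn.div (by fun_prop) (by fun_prop) fun y hy => ?_).norm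
  exact ofReal_sub_circleMap_ne_zero hR (hKc y hy) θ

end Supremum

theorem lanczos_fa_error_integral_bound
    {n k : ℕ} (hn : 0 < n) (hk : 0 < k)
    (A : Matrix (Fin n) (Fin n) ℂ) (hA : A.IsHermitian)
    (b : Fin n → ℂ) (hb : b ≠ 0)
    (Q : Matrix (Fin n) (Fin k) ℂ) (hQ : Qᴴ * Q = 1)
    (hQb : Q.mulVec (Pi.single (⟨0, hk⟩ : Fin k) 1) = (norm2 b)⁻¹ • b)
    (T : Matrix (Fin k) (Fin k) ℝ) (hTsymm : T.IsSymm)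
    (hTtri : ∀ i j : Fin k, (i : ℕ) + 1 < (j : ℕ) ∨ (j : ℕ) + 1 < (i : ℕ) → T i j = 0)
    (hToff : ∀ i j : Fin k, (i : ℕ) + 1 = (j : ℕ) → 0 < T i j)
    (βk : ℝ) (hβk : 0 < βk)
    (q : Fin n → ℂ) (hq : norm2 q = 1) (hQq : Qᴴ.mulVec q = 0)
    (hAQ : A * Q = Q * T.map Complex.ofReal + (βk : ℂ) •
      Matrix.vecMulVec q (Pi.single (⟨k - 1, Nat.sub_lt hk Nat.one_pos⟩ : Fin k) 1))
    (hTH : (T.map Complex.ofReal).IsHermitian)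
    (c R : ℝ) (hR : 0 < R)
    (hspecA : ∀ i, |hA.eigenvalues i - c| < R)
    (hspecT : ∀ i, |hTH.eigenvalues i - c| < R)
    (f : ℂ → ℂ)
    (hf : ∃ U : Set ℂ, IsOpen U ∧ Metric.closedBall (c : ℂ) R ⊆ U ∧ DifferentiableOn ℂ f U)
    (w : ℝ) (hwA : ∀ i, hA.eigenvalues i ≠ w) (hwT : ∀ i, hTH.eigenvalues i ≠ w)
    (S : Fin (k + 1) → Set ℝ)
    (hSne : ∀ i, (S i).Nonempty) (hScpt : ∀ i, IsCompact (S i))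
    (hScirc : ∀ i, ∀ x ∈ S i, |x - c| ≠ R)
    (hSA : ∀ i, hA.eigenvalues i ∈ S 0)
    (hST : ∀ i : Fin k, hTH.eigenvalues i ∈ S i.succ)
    (M : Matrix (Fin n) (Fin n) ℂ) (hM : M.PosDef) (hMA : M * A = A * M) :
    normM M ((matFun hA fun x : ℝ => f (x : ℂ)).mulVec b -
        (Q * matFun hTH (fun x : ℝ => f (x : ℂ)) * Qᴴ).mulVec b) ≤
      ((2 * Real.pi)⁻¹ *
          ∫ θ in (0 : ℝ)..(2 * Real.pi),
            ‖f ((c : ℂ) + R * Complex.exp (θ * Complex.I))‖ *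
              (∏ i : Fin k,
                sSup ((fun x : ℝ =>
                  ‖((x : ℂ) - (w : ℂ)) / ((x : ℂ) - ((c : ℂ) + R * Complex.exp (θ * Complex.I)))‖)
                  '' S i.succ)) *
              sSup ((fun x : ℝ =>
                ‖((x : ℂ) - (w : ℂ)) / ((x : ℂ) - ((c : ℂ) + R * Complex.exp (θ * Complex.I)))‖)
                '' S 0) * R) *
        normM M (errK A Q (T.map Complex.ofReal) b (w : ℂ)) := by
  obtain ⟨U, -, hUsub, hfU⟩ := hf
  have hfd : DifferentiableOn ℂ f (Metric.closedBall (c : ℂ) R) := hfU.mono hUsub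
  obtain ⟨L, hL⟩ := exists_normM_eq_norm hM
  have hnb : norm2 b ≠ 0 := by
    intro h
    apply hb
    rw [norm2, Real.sqrt_eq_zero (Finset.sum_nonneg fun i _ => sq_nonneg _),
      Finset.sum_eq_zero_iff_of_nonneg fun i _ => sq_nonneg _] at h
    ext i
    simpa using h i (Finset.mem_univ i)
  have hQb' : b = (norm2 b : ℂ) • Q *ᵥ Pi.single (⟨0, hk⟩ : Fin k) 1 := by
    rw [hQb]
    ext i
    simp [hnb]
  have hT0 : ∀ i j : Fin k, (j : ℕ) + 1 < (i : ℕ) → T.map Complex.ofReal i j = 0 :=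
    fun i j hij => by simp [hTtri i j (Or.inr hij)]
  have hcircle : ∀ θ : ℝ, (c : ℂ) + R * Complex.exp (θ * Complex.I) = circleMap c R θ :=
    fun _ => rfl
  simp only [hcircle]
  set σ : Fin (k + 1) → ℝ → ℝ := fun i θ =>
    sSup ((fun x : ℝ => ‖((x : ℂ) - w) / ((x : ℂ) - circleMap c R θ)‖) '' S i) with hσ
  have hσcont : ∀ i, Continuous (σ i) := fun i =>
    continuous_sSup_norm_div_circleMap hR (hScpt i) (hScirc i) w
  have hσle : ∀ i θ, ∀ x ∈ S i, ‖((x : ℂ) - w) / ((x : ℂ) - circleMap c R θ)‖ ≤ σ i θ :=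
    fun i θ x hx => norm_div_circleMap_le_sSup hR (hScpt i) (hScirc i) w θ hx
  have hσnn : ∀ i θ, 0 ≤ σ i θ := fun i θ =>
    (norm_nonneg _).trans (hσle i θ _ (hSne i).choose_spec)
  have hfcont : Continuous fun θ => f (circleMap c R θ) :=
    hfd.continuousOn.comp_continuous (continuous_circleMap _ _)
      fun θ => circleMap_mem_closedBall _ hR.le θ
  set e := normM M (errK A Q (T.map Complex.ofReal) b (w : ℂ)) with he
  have herr : ∀ θ, ‖L (errK A Q (T.map Complex.ofReal) b (circleMap c R θ))‖ ≤
      (∏ i : Fin k, σ i.succ θ) * σ 0 θ * e := by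
    intro θ
    rw [errK_eq_smul_matFun_mulVec hk hA hQ hQb' hTH hT0 hAQ
      (fun i => sub_ne_zero.1 (ofReal_sub_circleMap_ne_zero hR (hspecA i).ne θ))
      (fun i => sub_ne_zero.1 (ofReal_sub_circleMap_ne_zero hR (hspecT i).ne θ))
      (fun i => Complex.ofReal_injective.ne (hwA i))
      (fun i => Complex.ofReal_injective.ne (hwT i)), map_smul, norm_smul, norm_prod, mul_assoc,
      ← hL]
    refine mul_le_mul (Finset.prod_le_prod (fun _ _ => norm_nonneg _)
      fun i _ => hσle _ _ _ (hST i)) ?_ (Real.sqrt_nonneg _)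
      (Finset.prod_nonneg fun i _ => hσnn _ θ)
    exact normM_matFun_mulVec_le hM hA hMA _ (hσnn 0 θ) (fun i => hσle 0 θ _ (hSA i)) _
  have hcauchy := congrArg norm (two_pi_I_smul_matFun_error hA b Q hTH hR hspecA hspecT hfd L)
  have h2pi : (0 : ℝ) < 2 * Real.pi := Real.two_pi_pos
  rw [norm_smul, norm_neg, ← hL, show ‖(2 * Real.pi * Complex.I : ℂ)‖ = 2 * Real.pi by
    simp [Real.pi_pos.le]] at hcauchy
  rw [mul_assoc, ← div_eq_inv_mul, le_div_iff₀' h2pi, hcauchy, circleIntegral,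
    ← intervalIntegral.integral_mul_const]
  refine intervalIntegral.norm_integral_le_of_norm_le h2pi.le (.of_forall fun θ _ => ?_)
    (Continuous.intervalIntegrable ?_ _ _)
  · rw [norm_smul, norm_smul, deriv_circleMap, norm_mul, norm_circleMap_zero, Complex.norm_I,
      mul_one, abs_of_pos hR]
    calc R * (‖f (circleMap c R θ)‖ * ‖L (errK A Q (T.map Complex.ofReal) b (circleMap c R θ))‖)
        ≤ R * (‖f (circleMap c R θ)‖ * ((∏ i : Fin k, σ i.succ θ) * σ 0 θ * e)) := by
          gcongr
          exact herr θ
      _ = _ := by ring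
  · have hprod : Continuous fun θ => ∏ i : Fin k, σ i.succ θ :=
      continuous_finsetProd _ fun i _ => hσcont _
    exact (((hfcont.norm.mul hprod).mul (hσcont 0)).mul continuous_const).mul continuous_const
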